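/- There exists a constant C > 0 with the following property: for every continuous function V : [0,1/2] × ℝ → ℝ satisfying V(0,t) = t, cos(V(e,t)) = C(e,t) and sin(V(e,t)) = S(e,t) for all (e,t), one has |V(e,t) − t − 2e·sin(t)| ≤ C·e² for all e ∈ [0,1/2] and all t ∈ ℝ; that is, the true anomaly has the uniform first-order expansion V(e,t) = t + 2e·sin(t) + O(e²). -/

import Mathlib

theorem abs_sin_sub_le (a b : ℝ) : |Real.sin a - Real.sin b| ≤ |a - b| := by
  rw [Real.sin_sub_sin, abs_mul, abs_mul, abs_two]
  have h1 := Real.abs_sin_le_abs (x := (a - b) / 2)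
  have h2 := Real.abs_cos_le_one ((a + b) / 2)
  rw [abs_div, abs_two] at h1
  nlinarith [abs_nonneg (Real.sin ((a - b) / 2)), abs_nonneg (Real.cos ((a + b) / 2))]

theorem sqrt_facts (e : ℝ) (he : e ∈ Set.Icc (0:ℝ) (1/2)) :
    1 - e ^ 2 ≤ Real.sqrt (1 - e ^ 2) ∧ Real.sqrt (1 - e ^ 2) ≤ 1 := by
  obtain ⟨h0, h1⟩ := he
  constructor
  · apply Real.le_sqrt_of_sq_le
    have h2 : e ^ 2 ≤ 1 := by nlinarith
    nlinarith [sq_nonneg e]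
  · rw [Real.sqrt_le_one]; nlinarith

theorem denom_pos (e u : ℝ) (he : e ∈ Set.Icc (0:ℝ) (1/2)) :
    1 / 2 ≤ 1 - e * Real.cos u := by
  obtain ⟨h0, h1⟩ := he
  nlinarith [Real.cos_le_one u]

theorem cos_diff_pos (e u v : ℝ) (he : e ∈ Set.Icc (0:ℝ) (1/2))
    (hc : Real.cos v = (Real.cos u - e) / (1 - e * Real.cos u))
    (hs : Real.sin v = Real.sqrt (1 - e ^ 2) * Real.sin u / (1 - e * Real.cos u)) :
    0 < Real.cos (v - u) := by
  have hd := denom_pos e u he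
  obtain ⟨hs1, hs2⟩ := sqrt_facts e he
  set s := Real.sqrt (1 - e ^ 2)
  have hE : Real.cos (v - u) =
      (1 - e * Real.cos u - (1 - s) * Real.sin u ^ 2) / (1 - e * Real.cos u) := by
    rw [Real.cos_sub, hc, hs, div_mul_eq_mul_div, div_mul_eq_mul_div, ← add_div]
    congr 1
    linear_combination Real.sin_sq_add_cos_sq u
  rw [hE]
  apply div_pos _ (by linarith)
  obtain ⟨h0, h1⟩ := he
  nlinarith [Real.sin_sq_le_one u, sq_nonneg (Real.sin u)]

theorem sin_diff_bound (e u v : ℝ) (he : e ∈ Set.Icc (0:ℝ) (1/2))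
    (hc : Real.cos v = (Real.cos u - e) / (1 - e * Real.cos u))
    (hs : Real.sin v = Real.sqrt (1 - e ^ 2) * Real.sin u / (1 - e * Real.cos u)) :
    |Real.sin (v - u) - e * Real.sin u| ≤ 2 * e ^ 2 := by
  have hd := denom_pos e u he
  obtain ⟨hs1, hs2⟩ := sqrt_facts e he
  set s := Real.sqrt (1 - e ^ 2)
  have hne : 1 - e * Real.cos u ≠ 0 := by linarith
  have hE : Real.sin (v - u) - e * Real.sin u =
      ((e ^ 2 - (1 - s)) * (Real.sin u * Real.cos u)) / (1 - e * Real.cos u) := by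
    rw [Real.sin_sub, hc, hs]
    field_simp
    ring
  have hp : 0 < 1 - e * Real.cos u := by linarith
  rw [hE, abs_div, abs_of_pos hp, div_le_iff₀ hp, abs_mul, abs_mul,
    abs_of_nonneg (by linarith : 0 ≤ e ^ 2 - (1 - s))]
  have h1 : |Real.sin u| * |Real.cos u| ≤ 1 :=
    mul_le_one₀ (Real.abs_sin_le_one u) (abs_nonneg _) (Real.abs_cos_le_one u)
  have h2 : (e ^ 2 - (1 - s)) * (|Real.sin u| * |Real.cos u|) ≤ e ^ 2 - (1 - s) :=
    mul_le_of_le_one_right (by linarith) h1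
  nlinarith [sq_nonneg e]

theorem sub_sin_bound (x : ℝ) (hx : |x| ≤ Real.pi / 2) :
    |x - Real.sin x| ≤ 8 * Real.sin x ^ 2 := by
  have h1 := Real.mul_abs_le_abs_sin hx
  have hpi := Real.pi_le_four
  have hpp := Real.pi_pos
  have h2 : |x| ≤ 2 * |Real.sin x| := by
    have : 1 / 2 ≤ 2 / Real.pi := by
      rw [div_le_div_iff₀ (by norm_num) hpp]; linarith
    nlinarith [abs_nonneg x]
  have h3 : |x| ^ 2 ≤ 4 * Real.sin x ^ 2 := by
    rw [← sq_abs (Real.sin x)]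
    nlinarith [abs_nonneg x]
  have h4 : |x - Real.sin x| ≤ 2 * |x| ^ 2 := by
    rcases le_total |x| 1 with h | h
    · have hb := Real.sin_bound h
      have hxx : |x| ^ 5 ≤ |x| ^ 2 := pow_le_pow_of_le_one (abs_nonneg x) h (by norm_num)
      have hx3 : |x ^ 3| ≤ |x| ^ 2 := by
        rw [abs_pow]; exact pow_le_pow_of_le_one (abs_nonneg x) h (by norm_num)
      have hn := sq_nonneg |x|
      have hf := pow_nonneg (abs_nonneg x) 5
      rw [abs_le] at hb hx3 ⊢
      constructor <;> linarith
    · have := abs_sub x (Real.sin x)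
      have h5 := Real.abs_sin_le_abs (x := x)
      nlinarith
  linarith

/-- `C(e,ℓ) = (cos(u(e,ℓ)) − e)/(1 − e·cos(u(e,ℓ)))`, the cosine of the true anomaly. -/
noncomputable def Cfun (U : ℝ → ℝ → ℝ) (e ℓ : ℝ) : ℝ :=
  (Real.cos (U e ℓ) - e) / (1 - e * Real.cos (U e ℓ))

/-- `S(e,ℓ) = √(1−e²)·sin(u(e,ℓ))/(1 − e·cos(u(e,ℓ)))`, the sine of the true anomaly. -/
noncomputable def Sfun (U : ℝ → ℝ → ℝ) (e ℓ : ℝ) : ℝ :=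
  Real.sqrt (1 - e ^ 2) * Real.sin (U e ℓ) / (1 - e * Real.cos (U e ℓ))

/-- There is a constant `C > 0` such that for every continuous
`V : [0,1/2] × ℝ → ℝ` with `V(0,t) = t`, `cos(V(e,t)) = C(e,t)` and
`sin(V(e,t)) = S(e,t)`, one has `|V(e,t) − t − 2e·sin t| ≤ C·e²` for all
`e ∈ [0,1/2]` and `t ∈ ℝ`. -/
theorem stmt_5 (U : ℝ → ℝ → ℝ)
    (hU : ∀ e ∈ Set.Ico (0:ℝ) 1, ∀ ℓ : ℝ, U e ℓ - e * Real.sin (U e ℓ) = ℓ) :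
    ∃ C > 0, ∀ V : ℝ → ℝ → ℝ,
      ContinuousOn (fun p : ℝ × ℝ => V p.1 p.2)
        (Set.Icc (0:ℝ) (1/2) ×ˢ (Set.univ : Set ℝ)) →
      (∀ t : ℝ, V 0 t = t) →
      (∀ e ∈ Set.Icc (0:ℝ) (1/2), ∀ t : ℝ,
        Real.cos (V e t) = Cfun U e t ∧ Real.sin (V e t) = Sfun U e t) →
      ∀ e ∈ Set.Icc (0:ℝ) (1/2), ∀ t : ℝ,
        |V e t - t - 2 * e * Real.sin t| ≤ C * e ^ 2 := by
  refine ⟨40, by norm_num, ?_⟩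
  intro V hVc hV0 hV e he t
  have hu := fun e (he : e ∈ Set.Icc (0:ℝ) (1/2)) =>
    hU e ⟨he.1, by linarith [he.2]⟩ t
  have hlip : LipschitzOnWith 2 (fun e => U e t) (Set.Icc (0:ℝ) (1/2)) := by
    apply LipschitzOnWith.of_dist_le_mul
    intro a ha b hb
    rw [Real.dist_eq, Real.dist_eq]
    have h1 := hu a ha
    have h2 := hu b hb
    have h3 : U a t - U b t = (a - b) * Real.sin (U a t)
        + b * (Real.sin (U a t) - Real.sin (U b t)) := by linarith
    have h4 : |(a - b) * Real.sin (U a t)| ≤ |a - b| := by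
      rw [abs_mul]
      exact mul_le_of_le_one_right (abs_nonneg _) (Real.abs_sin_le_one _)
    have h5 : |b * (Real.sin (U a t) - Real.sin (U b t))| ≤ 1/2 * |U a t - U b t| := by
      rw [abs_mul, abs_of_nonneg hb.1]
      exact mul_le_mul hb.2 (abs_sin_sub_le _ _) (abs_nonneg _) (by norm_num)
    have h6 := abs_add_le ((a - b) * Real.sin (U a t)) (b * (Real.sin (U a t) - Real.sin (U b t)))
    rw [← h3] at h6
    simp only [NNReal.coe_ofNat]
    linarith
  have hUc : ContinuousOn (fun e => U e t) (Set.Icc (0:ℝ) (1/2)) := hlip.continuousOn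
  have hVc' : ContinuousOn (fun e => V e t) (Set.Icc (0:ℝ) (1/2)) :=
    hVc.comp (f := fun e : ℝ => (e, t)) (by fun_prop) (fun x hx => ⟨hx, trivial⟩)
  have hxc : ContinuousOn (fun e => V e t - U e t) (Set.Icc (0:ℝ) (1/2)) := hVc'.sub hUc
  have hx0 : V 0 t - U 0 t = 0 := by
    have := hu 0 ⟨le_rfl, by norm_num⟩
    rw [hV0]; linarith
  have hcos : ∀ a ∈ Set.Icc (0:ℝ) (1/2), 0 < Real.cos (V a t - U a t) := by
    intro a ha
    obtain ⟨hc, hs⟩ := hV a ha t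
    exact cos_diff_pos a _ _ ha hc hs
  have hlt : |V e t - U e t| < Real.pi / 2 := by
    by_contra hcon
    push Not at hcon
    have hc : ContinuousOn (fun e => |V e t - U e t|) (Set.Icc (0:ℝ) e) :=
      (hxc.mono (Set.Icc_subset_Icc_right he.2)).abs
    have hiv := intermediate_value_Icc he.1 hc
    have hmem : Real.pi / 2 ∈ Set.Icc |V 0 t - U 0 t| |V e t - U e t| := by
      rw [hx0, abs_zero]; exact ⟨by positivity, hcon⟩
    obtain ⟨a, ha, hae⟩ := hiv hmem
    have h := hcos a ⟨ha.1, ha.2.trans he.2⟩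
    simp only at hae
    rw [← Real.cos_abs, hae, Real.cos_pi_div_two] at h
    exact lt_irrefl _ h
  obtain ⟨hc, hs⟩ := hV e he t
  have hk := sin_diff_bound e _ _ he hc hs
  have hx := sub_sin_bound _ hlt.le
  have hut := hu e he
  have h1 : |Real.sin (U e t) - Real.sin t| ≤ e := by
    refine (abs_sin_sub_le _ _).trans ?_
    have : U e t - t = e * Real.sin (U e t) := by linarith
    rw [this, abs_mul, abs_of_nonneg he.1]
    exact mul_le_of_le_one_right he.1 (Real.abs_sin_le_one _)
  have hsu : |e * Real.sin (U e t)| ≤ e := by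
    rw [abs_mul, abs_of_nonneg he.1]
    exact mul_le_of_le_one_right he.1 (Real.abs_sin_le_one _)
  have he0 := he.1
  have he1 := he.2
  have hsx : |Real.sin (V e t - U e t)| ≤ 2 * e := by
    rw [abs_le] at *
    constructor <;> nlinarith
  have hsq : Real.sin (V e t - U e t) ^ 2 ≤ 4 * e ^ 2 := by
    rw [← sq_abs]; nlinarith [abs_nonneg (Real.sin (V e t - U e t))]
  have h2 : |e * (Real.sin (U e t) - Real.sin t)| ≤ e ^ 2 := by
    rw [abs_mul, abs_of_nonneg he.1]; nlinarith
  rw [abs_le] at hx hk h2 ⊢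
  constructor <;> nlinarith
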